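/- arXiv:2404.06342 — 2 statements merged into one kernel-verified Lean document; each statement's English description precedes it below -/
import Mathlib

section
/- Under the assumptions of the proximal-gradient convergence theorem — namely: n, m positive integers, 0 < c0 < c1, K01 = [c0,c1]^n, K ⊆ K01 nonempty compact convex; Φ : ℝⁿ → ℝᵐ differentiable with Jacobian J_Φ(σ); R : ℝⁿ → ℝ nonnegative, convex, continuous; λ, ρ, μ > 0; Λ ∈ ℝᵐ; RIP with constants 0 < α ≤ β on K01; mild nonlinearity with constant γ > 0 on K01; μ ≤ 1/(2β), μ ≤ 1/(2λρ), α + λρ − 2γ > 0 — let (σⁿ) be the proximal-gradient iterates with σ⁰ ∈ K and σⁿ⁺¹ ∈ K minimizing σ ↦ (1/2)‖σ − (σⁿ − μλρσⁿ + μ J_Φ(σⁿ)ᵀ(Λ − Φ(σⁿ)))‖² + μλ R(σ) over K. Then every cluster point σ̄ of (σⁿ) satisfies, for every σ ∈ K, ‖σ − σ̄‖² ≤ (4/(α + λρ − 2γ)) · ((1/2)‖Φ(σ) − Λ‖² + (λρ/2)‖σ‖² + λ R(σ)). -/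
open scoped RealInnerProductSpace

/-- Three-point inequality: a minimizer `p` over a convex set of the prox objective
`z ↦ ‖z - y‖² / 2 + g z` minimizes it with a quadratic margin. -/
theorem prox_three_point {E : Type*} [NormedAddCommGroup E] [InnerProductSpace ℝ E]
    {K : Set E} (hK : Convex ℝ K) {g : E → ℝ} (hg : ConvexOn ℝ Set.univ g) {y p : E} (hp : p ∈ K)
    (hmin : ∀ z ∈ K, (1/2) * ‖p - y‖^2 + g p ≤ (1/2) * ‖z - y‖^2 + g z) {z : E} (hz : z ∈ K) :
    (1/2) * ‖p - y‖^2 + g p + (1/2) * ‖z - p‖^2 ≤ (1/2) * ‖z - y‖^2 + g z := by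
  have key : ∀ t : ℝ, 0 < t → t ≤ 1 →
      0 ≤ ⟪p - y, z - p⟫ + t * ((1/2) * ‖z - p‖^2) + (g z - g p) := by
    intro t ht ht1
    have hmem : (1 - t) • p + t • z ∈ K := hK hp hz (by linarith) ht.le (by ring)
    have h1 := hmin _ hmem
    have h2 := hg.2 (Set.mem_univ p) (Set.mem_univ z)
      (show (0 : ℝ) ≤ 1 - t by linarith) ht.le (by ring)
    have h3 : (1 - t) • p + t • z - y = (p - y) + t • (z - p) := by module
    rw [h3, norm_add_sq_real, norm_smul, mul_pow, inner_smul_right, Real.norm_eq_abs,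
      sq_abs] at h1
    simp only [smul_eq_mul] at h2
    by_contra! hneg
    nlinarith [mul_neg_of_pos_of_neg ht hneg]
  have hlim : 0 ≤ ⟪p - y, z - p⟫ + (g z - g p) := by
    refine le_of_forall_pos_le_add fun ε hε => ?_
    set D := (1/2) * ‖z - p‖^2 with hD
    have hD0 : 0 ≤ D := by positivity
    have ht : 0 < min 1 (ε / (D + 1)) := by positivity
    have h := key _ ht (min_le_left _ _)
    have h1 : min 1 (ε / (D + 1)) * D ≤ ε := by
      calc min 1 (ε / (D + 1)) * D ≤ (ε / (D + 1)) * (D + 1) := by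
            gcongr
            · exact min_le_right _ _
            · linarith
        _ = ε := by field_simp
    linarith
  have hexp : z - y = (p - y) + (z - p) := by abel
  rw [hexp, norm_add_sq_real]
  linarith

/-- Linearization bound for the Tikhonov-regularized least-squares functional, from the residual
`r`, the linearized increment `a` and the linearization error `e`. -/
theorem linearized_lsq_le {E F : Type*} [NormedAddCommGroup E] [InnerProductSpace ℝ E]
    [NormedAddCommGroup F] [InnerProductSpace ℝ F] {r a e : F} {s z : E} {α γ κ : ℝ}
    (ha : α * ‖z - s‖^2 ≤ ‖a‖^2) (he : ‖e‖^2 ≤ γ * ‖z - s‖^2) :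
    ⟪r, a⟫ + κ * ⟪s, z - s⟫ ≤ ‖r + a + e‖^2 + κ / 2 * ‖z‖^2
      - ((1/2) * ‖r‖^2 + κ / 2 * ‖s‖^2) - (1/2) * (α + κ - 2 * γ) * ‖z - s‖^2 := by
  have hz : ‖z‖^2 = ‖s‖^2 + 2 * ⟪s, z - s⟫ + ‖z - s‖^2 := by
    rw [← norm_add_sq_real, add_sub_cancel]
  have h1 : ‖r + a‖^2 = ‖r‖^2 + 2 * ⟪r, a⟫ + ‖a‖^2 := norm_add_sq_real _ _
  have h2 : ‖r + a + e‖^2 = ‖r + a‖^2 + 2 * ⟪r + a, e⟫ + ‖e‖^2 := norm_add_sq_real _ _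
  have h3 : ‖r + a + e + e‖^2 = ‖r + a + e‖^2 + 2 * ⟪r + a + e, e⟫ + ‖e‖^2 :=
    norm_add_sq_real _ _
  have h4 : ⟪r + a + e, e⟫ = ⟪r + a, e⟫ + ‖e‖^2 := by
    rw [inner_add_left, real_inner_self_eq_norm_sq]
  rw [hz]
  nlinarith [sq_nonneg ‖r + a + e + e‖]

/-- For small step sizes the linear model at `s`, with its proximal term, is bounded below by
minus the regularized least-squares value at `s`. -/
theorem neg_lsq_le_linear_model {E F : Type*} [NormedAddCommGroup E] [InnerProductSpace ℝ E]
    [NormedAddCommGroup F] [InnerProductSpace ℝ F] {r a : F} {s d : E} {β κ μ : ℝ}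
    (hμ : 0 ≤ μ) (hκ : 0 ≤ κ) (ha : ‖a‖^2 ≤ β * ‖d‖^2) (hμβ : μ * β ≤ 1/2) (hμκ : μ * κ ≤ 1/2) :
    -(μ * ((1/2) * ‖r‖^2 + κ / 2 * ‖s‖^2)) ≤ μ * (⟪r, a⟫ + κ * ⟪s, d⟫) + (1/2) * ‖d‖^2 := by
  have h1 := norm_add_sq_real r a
  have h2 := norm_add_sq_real s d
  have h3 : 0 ≤ μ * ‖r + a‖^2 := by positivity
  have h4 : 0 ≤ μ * κ * ‖s + d‖^2 := by positivity
  have h5 := mul_le_mul_of_nonneg_left ha hμ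
  have h6 := mul_le_mul_of_nonneg_right hμβ (sq_nonneg ‖d‖)
  have h7 := mul_le_mul_of_nonneg_right hμκ (sq_nonneg ‖d‖)
  rw [h1] at h3
  rw [h2] at h4
  nlinarith

/-- The limit along a subsequence of a sequence contracting affinely towards `M` is at most
`M`. -/
theorem le_of_tendsto_subseq_of_affine_contraction {D : ℕ → ℝ} {q M L : ℝ} (hq0 : 0 ≤ q)
    (hq1 : q < 1) (hD : ∀ k, D (k + 1) ≤ q * D k + (1 - q) * M) {φ : ℕ → ℕ} (hφ : StrictMono φ)
    (hL : Filter.Tendsto (D ∘ φ) Filter.atTop (nhds L)) : L ≤ M := by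
  have hk : ∀ k, D k ≤ M + q ^ k * (D 0 - M) := by
    intro k
    induction k with
    | zero => simp
    | succ k ih =>
      have h := mul_le_mul_of_nonneg_left ih hq0
      have h' := hD k
      rw [pow_succ]
      linarith
  have hlim : Filter.Tendsto (fun k => M + q ^ k * (D 0 - M)) Filter.atTop (nhds M) := by
    simpa using ((tendsto_pow_atTop_nhds_zero_of_lt_one hq0 hq1).mul_const (D 0 - M)).const_add M
  exact le_of_tendsto_of_tendsto' hL (hlim.comp hφ.tendsto_atTop) fun k => hk (φ k)


/-- Cluster-point bound (eq. 22) of Theorem 4.2 of the paper: every cluster point σ̄ of the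
proximal-gradient iterates satisfies ‖σ − σ̄‖² ≤ (4/(α + λρ − 2γ)) 𝒥(σ) for every σ ∈ K. -/
theorem stmt_9 (n m : ℕ) (hn : 0 < n) (hm : 0 < m) (c0 c1 : ℝ) (hc0 : 0 < c0) (hc1 : c0 < c1)
    (K01 : Set (EuclideanSpace ℝ (Fin n)))
    (hK01 : K01 = {σ : EuclideanSpace ℝ (Fin n) | ∀ i, σ i ∈ Set.Icc c0 c1})
    (K : Set (EuclideanSpace ℝ (Fin n))) (hKcomp : IsCompact K) (hKconv : Convex ℝ K)
    (hKne : K.Nonempty) (hKsub : K ⊆ K01)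
    (Φ : EuclideanSpace ℝ (Fin n) → EuclideanSpace ℝ (Fin m))
    (J : EuclideanSpace ℝ (Fin n) → (EuclideanSpace ℝ (Fin n) →L[ℝ] EuclideanSpace ℝ (Fin m)))
    (hJ : ∀ σ, HasFDerivAt Φ (J σ) σ)
    (R : EuclideanSpace ℝ (Fin n) → ℝ) (hR0 : ∀ σ, 0 ≤ R σ)
    (hRconv : ConvexOn ℝ Set.univ R) (hRcont : Continuous R)
    (lam ρ μ : ℝ) (hlam : 0 < lam) (hρ : 0 < ρ) (hμ : 0 < μ)
    (Λ : EuclideanSpace ℝ (Fin m))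
    -- (i) RIP
    (α β : ℝ) (hα : 0 < α) (hαβ : α ≤ β)
    (hRIPlow : ∀ σ ∈ K01, ∀ σ1 σ2 : EuclideanSpace ℝ (Fin n),
      α * ‖σ1 - σ2‖^2 ≤ ‖J σ (σ1 - σ2)‖^2)
    (hRIPup : ∀ σ ∈ K01, ∀ σ1 σ2 : EuclideanSpace ℝ (Fin n),
      ‖J σ (σ1 - σ2)‖^2 ≤ β * ‖σ1 - σ2‖^2)
    -- (ii) mild nonlinearity
    (γ : ℝ) (hγ : 0 < γ)
    (hmild : ∀ σ1 ∈ K01, ∀ σ2 ∈ K01,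
      ‖Φ σ1 - Φ σ2 - J σ2 (σ1 - σ2)‖^2 ≤ γ * ‖σ1 - σ2‖^2)
    -- (iii) parameter restrictions
    (hμβ : μ ≤ 1 / (2 * β)) (hμlamρ : μ ≤ 1 / (2 * lam * ρ))
    (hpos : 0 < α + lam * ρ - 2 * γ)
    -- the proximal-gradient iterates
    (σseq : ℕ → EuclideanSpace ℝ (Fin n)) (hσ0 : σseq 0 ∈ K)
    (hσmem : ∀ k : ℕ, σseq (k + 1) ∈ K)
    (hprox : ∀ k : ℕ, ∀ σ ∈ K,
      (1/2) * ‖σseq (k + 1) - (σseq k - (μ * lam * ρ) • σseq k +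
          μ • (ContinuousLinearMap.adjoint (J (σseq k)) (Λ - Φ (σseq k))))‖^2
        + μ * lam * R (σseq (k + 1)) ≤
      (1/2) * ‖σ - (σseq k - (μ * lam * ρ) • σseq k +
          μ • (ContinuousLinearMap.adjoint (J (σseq k)) (Λ - Φ (σseq k))))‖^2
        + μ * lam * R σ)
    -- a cluster point of the iterates
    (σbar : EuclideanSpace ℝ (Fin n)) (φ : ℕ → ℕ) (hφ : StrictMono φ)
    (hlim : Filter.Tendsto (σseq ∘ φ) Filter.atTop (nhds σbar)) :
    ∀ σ ∈ K,
      ‖σ - σbar‖^2 ≤ (4 / (α + lam * ρ - 2 * γ)) *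
        ((1/2) * ‖Φ σ - Λ‖^2 + (lam * ρ / 2) * ‖σ‖^2 + lam * R σ) := by
  intro σ hσ
  have hβ : 0 < β := hα.trans_le hαβ
  have hκ : 0 < lam * ρ := mul_pos hlam hρ
  have hμβ' : μ * β ≤ 1/2 := by
    rw [le_div_iff₀ (by positivity)] at hμβ
    linarith
  have hμκ : μ * (lam * ρ) ≤ 1/2 := by
    rw [le_div_iff₀ (by positivity)] at hμlamρ
    linarith
  have hmem : ∀ k, σseq k ∈ K := fun k => by cases k with
    | zero => exact hσ0
    | succ k => exact hσmem k
  set c := α + lam * ρ - 2 * γ with hc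
  set obj := (1/2) * ‖Φ σ - Λ‖^2 + (lam * ρ / 2) * ‖σ‖^2 + lam * R σ with hobj
  have hg : ConvexOn ℝ Set.univ fun z => μ * lam * R z := hRconv.smul (mul_pos hμ hlam).le
  have hstep : ∀ k, ‖σ - σseq (k + 1)‖^2 ≤
      (1 - μ * c) * ‖σ - σseq k‖^2 + (1 - (1 - μ * c)) * ((4 / c) * obj) := by
    intro k
    have h3 := prox_three_point hKconv hg (hσmem k) (hprox k) hσ
    set s := σseq k with hs
    set p := σseq (k + 1) with hp
    have hsK := hKsub (hmem k)
    have hup := neg_lsq_le_linear_model (r := Φ s - Λ) (s := s) hμ.le hκ.le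
      (hRIPup s hsK p s) hμβ' hμκ
    have hlow := linearized_lsq_le (r := Φ s - Λ) (κ := lam * ρ) (hRIPlow s hsK σ s)
      (hmild σ (hKsub hσ) s hsK)
    rw [show Φ s - Λ + J s (σ - s) + (Φ σ - Φ s - J s (σ - s)) = Φ σ - Λ by abel, ← hc] at hlow
    have hexp : ∀ z, ‖z - (s - (μ * lam * ρ) • s +
          μ • (ContinuousLinearMap.adjoint (J s) (Λ - Φ s)))‖^2 =
        ‖z - s‖^2 + 2 * (μ * (⟪Φ s - Λ, J s (z - s)⟫ + lam * ρ * ⟪s, z - s⟫)) +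
        ‖(μ * lam * ρ) • s - μ • (ContinuousLinearMap.adjoint (J s) (Λ - Φ s))‖^2 := by
      intro z
      rw [show z - (s - (μ * lam * ρ) • s +
          μ • (ContinuousLinearMap.adjoint (J s) (Λ - Φ s))) = (z - s) +
          ((μ * lam * ρ) • s - μ • (ContinuousLinearMap.adjoint (J s) (Λ - Φ s))) by abel,
        norm_add_sq_real, inner_sub_right, inner_smul_right, inner_smul_right,
        ContinuousLinearMap.adjoint_inner_right, ← neg_sub (Φ s) Λ, inner_neg_right,
        real_inner_comm s, real_inner_comm (Φ s - Λ)]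
      ring
    rw [hexp, hexp] at h3
    have hlow' := mul_le_mul_of_nonneg_left hlow hμ.le
    have hM : (1 - (1 - μ * c)) * ((4 / c) * obj) = 4 * (μ * obj) := by
      field_simp
      ring
    have hRp : 0 ≤ μ * (lam * R p) := mul_nonneg hμ.le (mul_nonneg hlam.le (hR0 p))
    have hRσ : 0 ≤ μ * (lam * R σ) := mul_nonneg hμ.le (mul_nonneg hlam.le (hR0 σ))
    have hσ0 : 0 ≤ μ * (lam * ρ * ‖σ‖^2) := by positivity
    rw [hM, hobj]
    linarith
  refine le_of_tendsto_subseq_of_affine_contraction (D := fun k => ‖σ - σseq k‖^2)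
    (q := 1 - μ * c) ?_ ?_ hstep hφ ?_
  · have h1 := mul_le_mul_of_nonneg_left hαβ hμ.le
    have h2 := mul_pos hμ hγ
    rw [hc]
    linarith
  · linarith [mul_pos hμ hpos]
  · exact ((tendsto_const_nhds.sub hlim).norm).pow 2
end

section
/- Let n be a positive integer and let G be a finite graph on vertices {1,…,n} with, for each vertex i, a neighbor set 𝒩ᵢ ⊆ {1,…,n} and positive weights w_{ik} > 0 for k ∈ 𝒩ᵢ. Define the graph total variation TV(x) = Σᵢ Σ_{k ∈ 𝒩ᵢ} w_{ik} |xᵢ − x_k| for x ∈ ℝⁿ. Let t > 0, 0 < c0 < c1, and σ ∈ ℝⁿ. Let x* be the unique minimizer over ℝⁿ of x ↦ (1/2)‖x − σ‖² + t·TV(x). Then the componentwise clamp of x* to [c0,c1] is the unique minimizer of x ↦ (1/2)‖x − σ‖² + t·TV(x) over the box [c0,c1]^n; i.e. the proximal map of g = TV + χ_{[c0,c1]^n} is summative: prox_{t g} = proj_{[c0,c1]^n} ∘ prox_{t·TV}. -/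
/-- Clamping to an interval splits an increment into two parts of equal sign: the increment of
the clamp and the increment of the residual. -/
theorem abs_clamp_residual_sub_add (a b c d : ℝ) (hcd : c ≤ d) :
    |(a - min (max a c) d) - (b - min (max b c) d)| + |min (max a c) d - min (max b c) d|
      = |a - b| := by
  rcases le_total a b with h | h
  · have h1 : min (max a c) d ≤ min (max b c) d := by gcongr
    have h2 : a - min (max a c) d ≤ b - min (max b c) d := by grind
    rw [abs_of_nonpos (by linarith), abs_of_nonpos (by linarith), abs_of_nonpos (by linarith)]
    ring
  · have h1 : min (max b c) d ≤ min (max a c) d := by gcongr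
    have h2 : b - min (max b c) d ≤ a - min (max a c) d := by grind
    rw [abs_of_nonneg (by linarith), abs_of_nonneg (by linarith), abs_of_nonneg (by linarith)]
    ring

/-- Moving `a`, `b` towards `x`, `y` relative to their clamps changes the absolute difference by
at most the corresponding change measured from the clamps. -/
theorem abs_add_smul_sub_clamp_le (a b x y c d s : ℝ) (hcd : c ≤ d) (hs0 : 0 ≤ s) (hs1 : s ≤ 1) :
    |(a + s * (x - min (max a c) d)) - (b + s * (y - min (max b c) d))|
      ≤ |a - b| + s * (|x - y| - |min (max a c) d - min (max b c) d|) := by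
  have h := abs_clamp_residual_sub_add a b c d hcd
  set u := min (max a c) d
  set v := min (max b c) d
  calc |(a + s * (x - u)) - (b + s * (y - v))|
      = |(1 - s) * (a - b) + s * (((a - u) - (b - v)) + (x - y))| := by ring_nf
    _ ≤ |(1 - s) * (a - b)| + |s * (((a - u) - (b - v)) + (x - y))| := abs_add_le _ _
    _ = (1 - s) * |a - b| + s * |((a - u) - (b - v)) + (x - y)| := by
        rw [abs_mul, abs_mul, abs_of_nonneg hs0, abs_of_nonneg (sub_nonneg.2 hs1)]
    _ ≤ (1 - s) * |a - b| + s * (|(a - u) - (b - v)| + |x - y|) := by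
        gcongr
        exact abs_add_le _ _
    _ = |a - b| + s * (|x - y| - |u - v|) := by rw [← h]; ring

/-- Variational inequality characterizing the clamp as a projection. -/
theorem sub_clamp_mul_sub_clamp_nonpos (a x c d : ℝ) (hx : x ∈ Set.Icc c d) :
    (x - min (max a c) d) * (a - min (max a c) d) ≤ 0 := by
  obtain ⟨hc, hd⟩ := hx
  rcases le_total a c with h | h
  · rw [max_eq_right h, min_eq_left (hc.trans hd)]
    exact mul_nonpos_of_nonneg_of_nonpos (by linarith) (by linarith)
  · rw [max_eq_left h]
    rcases le_total a d with h' | h'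
    · simp [min_eq_left h']
    · rw [min_eq_right h']
      exact mul_nonpos_of_nonpos_of_nonneg (by linarith) (by linarith)

/-- A real number that is nonnegative after adding arbitrarily small multiples of a fixed number
is nonnegative. -/
theorem nonneg_of_forall_add_mul_nonneg {A B : ℝ}
    (h : ∀ s : ℝ, 0 < s → s ≤ 1 → 0 ≤ A + s * B) : 0 ≤ A := by
  by_contra! hA
  have hB : 0 < 1 + |B| := by positivity
  have hAB : 0 < -A / (1 + |B|) := div_pos (by linarith) hB
  set s := min 1 (-A / (1 + |B|))
  have hs0 : 0 < s := lt_min one_pos hAB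
  have h1 : s * (1 + |B|) ≤ -A := (le_div_iff₀ hB).1 (min_le_right _ _)
  have h2 := h s hs0 (min_le_left _ _)
  nlinarith [mul_le_mul_of_nonneg_left (le_abs_self B) hs0.le]


/-- Proposition 5.1 of the paper for the anisotropic graph Total Variation regularizer and
the box constraint: the proximal map of g = TV + χ_{[c0,c1]ⁿ} is summative, i.e. the
componentwise clamp of the unconstrained TV-proximal point is the unique minimizer over
the box. -/
theorem stmt_16 (n : ℕ) (hn : 0 < n)
    (N : Fin n → Finset (Fin n)) (w : Fin n → Fin n → ℝ)
    (hw : ∀ i : Fin n, ∀ k ∈ N i, 0 < w i k)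
    (t : ℝ) (ht : 0 < t) (c0 c1 : ℝ) (hc0 : 0 < c0) (hc1 : c0 < c1)
    (σ : EuclideanSpace ℝ (Fin n))
    (TV : EuclideanSpace ℝ (Fin n) → ℝ)
    (hTV : ∀ x : EuclideanSpace ℝ (Fin n), TV x = ∑ i, ∑ k ∈ N i, w i k * |x i - x k|)
    (xstar : EuclideanSpace ℝ (Fin n))
    (hmin : ∀ x : EuclideanSpace ℝ (Fin n),
      (1/2) * ‖xstar - σ‖^2 + t * TV xstar ≤ (1/2) * ‖x - σ‖^2 + t * TV x)
    (huniq : ∀ x : EuclideanSpace ℝ (Fin n),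
      (∀ y : EuclideanSpace ℝ (Fin n),
        (1/2) * ‖x - σ‖^2 + t * TV x ≤ (1/2) * ‖y - σ‖^2 + t * TV y) → x = xstar) :
    ∃ z : EuclideanSpace ℝ (Fin n),
      (∀ i : Fin n, z i = min (max (xstar i) c0) c1) ∧
      (∀ i : Fin n, z i ∈ Set.Icc c0 c1) ∧
      (∀ x : EuclideanSpace ℝ (Fin n), (∀ i, x i ∈ Set.Icc c0 c1) →
        (1/2) * ‖z - σ‖^2 + t * TV z ≤ (1/2) * ‖x - σ‖^2 + t * TV x) ∧
      (∀ x : EuclideanSpace ℝ (Fin n), (∀ i, x i ∈ Set.Icc c0 c1) →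
        (∀ y : EuclideanSpace ℝ (Fin n), (∀ i, y i ∈ Set.Icc c0 c1) →
          (1/2) * ‖x - σ‖^2 + t * TV x ≤ (1/2) * ‖y - σ‖^2 + t * TV y) → x = z) := by
  set z : EuclideanSpace ℝ (Fin n) := WithLp.toLp 2 fun i => min (max (xstar i) c0) c1
  have hzi : ∀ i, z i = min (max (xstar i) c0) c1 := fun i => rfl
  have hzK : ∀ i, z i ∈ Set.Icc c0 c1 := fun i => by
    rw [hzi]
    exact ⟨le_min (le_max_right _ _) hc1.le, min_le_right _ _⟩
  have key : ∀ x : EuclideanSpace ℝ (Fin n), (∀ i, x i ∈ Set.Icc c0 c1) →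
      (1/2) * ‖z - σ‖^2 + t * TV z + (1/2) * ‖x - z‖^2 ≤ (1/2) * ‖x - σ‖^2 + t * TV x := by
    intro x hx
    have hTVs : ∀ s : ℝ, 0 ≤ s → s ≤ 1 →
        TV (xstar + s • (x - z)) ≤ TV xstar + s * (TV x - TV z) := by
      intro s hs0 hs1
      simp only [hTV, ← Finset.sum_sub_distrib, Finset.mul_sum, ← Finset.sum_add_distrib]
      refine Finset.sum_le_sum fun i _ => Finset.sum_le_sum fun k hk => ?_
      have h := mul_le_mul_of_nonneg_left (abs_add_smul_sub_clamp_le (xstar i) (xstar k)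
        (x i) (x k) c0 c1 s hc1.le hs0 hs1) (hw i k hk).le
      rw [← hzi, ← hzi] at h
      simp only [PiLp.add_apply, PiLp.smul_apply, PiLp.sub_apply, smul_eq_mul]
      linarith
    have hproj : inner ℝ (xstar - z) (x - z) ≤ 0 := by
      rw [PiLp.inner_apply]
      exact Finset.sum_nonpos fun i _ => sub_clamp_mul_sub_clamp_nonpos _ _ _ _ (hx i)
    have hvar : 0 ≤ inner ℝ (xstar - σ) (x - z) + t * (TV x - TV z) := by
      refine nonneg_of_forall_add_mul_nonneg (B := (1/2) * ‖x - z‖^2) fun s hs0 hs1 => ?_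
      have h1 := hmin (xstar + s • (x - z))
      have h2 := mul_le_mul_of_nonneg_left (hTVs s hs0.le hs1) ht.le
      rw [add_sub_right_comm, norm_add_sq_real, inner_smul_right, norm_smul, mul_pow,
        Real.norm_eq_abs, sq_abs] at h1
      refine nonneg_of_mul_nonneg_right (a := s) ?_ hs0
      linarith
    have hexp : ‖x - σ‖^2 = ‖z - σ‖^2 + 2 * inner ℝ (z - σ) (x - z) + ‖x - z‖^2 := by
      rw [← norm_add_sq_real]
      congr 2
      abel
    have hsplit : inner ℝ (xstar - σ) (x - z)
        = inner ℝ (xstar - z) (x - z) + inner ℝ (z - σ) (x - z) := by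
      rw [← inner_add_left, sub_add_sub_cancel]
    linarith
  refine ⟨z, hzi, hzK, fun x hx => ?_, fun x hx hxmin => ?_⟩
  · linarith [key x hx, sq_nonneg ‖x - z‖]
  · have h : ‖x - z‖^2 ≤ 0 := by linarith [key x hx, hxmin z hzK]
    exact sub_eq_zero.1 (norm_eq_zero.1 (pow_eq_zero_iff two_ne_zero |>.1
      (le_antisymm h (sq_nonneg _))))
end
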